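/- Let λ ∈ [0,1) and let F be a λ-regular CDF with density f on [a,b) ⊆ [0,∞) such that the maximum of n i.i.d. draws from F is integrable. Let n ≥ k ≥ 1 be integers, s = ⌈n/k⌉, s' = s − 1 if s ≥ 2 and s' = 1 if s = 1, and p = E[v^{(1,s)}]. Then k·p·(1 − F(p)^{s'}) ≥ (c(λ)/2)·(1 − 1/e)·∑_{j=1}^k E[v^{(j,n)}]. (This is the revenue guarantee of the Intermediary-Proof Mechanism of Theorem 1: the left side lower-bounds its expected revenue divided by τ, and the right side is (c(λ)/2)(1 − 1/e) times the expected optimal welfare ∑_{j=1}^k E[v^{(j,n)}].) -/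

import Mathlib

open MeasureTheory Filter

/-- The `j`-th largest value (1-indexed) among the `t` coordinates of `v`. -/
noncomputable def orderStat (t j : ℕ) (v : Fin t → ℝ) : ℝ :=
  ((List.ofFn v).insertionSort (· ≤ ·)).getD (t - j) 0

/-- The expectation of the `j`-th largest of `t` i.i.d. draws from `μ`. -/
noncomputable def orderStatExp (μ : Measure ℝ) (j t : ℕ) : ℝ :=
  ∫ v, orderStat t j v ∂(Measure.pi fun _ : Fin t => μ)

/-- `F` is a CDF with density `f` on `[a, b)` (where possibly `b = ∞`):
differentiable with positive derivative `f` there, `F a = 0`, `F` nondecreasing,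
and `F x → 1` as `x → b`. -/
def IsCDF (F f : ℝ → ℝ) (a : ℝ) (b : EReal) : Prop :=
  (a : EReal) < b ∧ Monotone F ∧ F a = 0 ∧
  (∀ x : ℝ, a ≤ x → (x : EReal) < b → HasDerivAt F (f x) x ∧ 0 < f x) ∧
  Tendsto F (Filter.comap (fun x : ℝ => (x : EReal)) (nhdsWithin b (Set.Iio b))) (nhds 1)

/-- `μ` is the probability measure on `[a, b)` induced by the CDF `F`. -/
def InducedBy (μ : Measure ℝ) (F : ℝ → ℝ) (a : ℝ) (b : EReal) : Prop :=
  IsProbabilityMeasure μ ∧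
  ∀ x : ℝ, a ≤ x → (x : EReal) < b → μ (Set.Iic x) = ENNReal.ofReal (F x)

/-- `λ`-regularity of the CDF `F` with density `f` on `[a, b)`. -/
def LambdaRegular (l : ℝ) (F f : ℝ → ℝ) (a : ℝ) (b : EReal) : Prop :=
  MonotoneOn (fun v => l * v - (1 - F v) / f v) {x : ℝ | a ≤ x ∧ (x : EReal) < b}

/-- `c(λ) = (1 - λ)^(1/λ)` for `λ ∈ (0,1]`, with `c(0) = 1/e`. -/
noncomputable def cReg (l : ℝ) : ℝ := if l = 0 then (Real.exp 1)⁻¹ else (1 - l) ^ (1 / l)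


/-- In an ascending list, the `j`-th entry from the end exceeds `x` iff at least `j` entries do. -/
lemma lt_getElem_iff_le_countP {l : List ℝ} (hl : l.SortedLE) {j : ℕ} (hj : 1 ≤ j)
    (hjl : j ≤ l.length) (x : ℝ) :
    x < l[l.length - j]'(by omega) ↔ j ≤ l.countP (fun y => decide (x < y)) := by
  constructor
  · intro hx
    have h : (l.drop (l.length - j)).countP (fun y => decide (x < y)) = j := by
      rw [List.countP_eq_length.2, List.length_drop]
      · omega
      · intro y hy
        obtain ⟨i, hi, rfl⟩ := List.mem_iff_getElem.1 hy
        rw [List.getElem_drop]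
        simpa using hx.trans_le (hl.getElem_le_getElem_of_le (by omega))
    calc j = (l.drop (l.length - j)).countP (fun y => decide (x < y)) := h.symm
      _ ≤ _ := (List.drop_sublist _ _).countP_le
  · contrapose!
    intro hx
    have h : (l.take (l.length - j + 1)).countP (fun y => decide (x < y)) = 0 := by
      rw [List.countP_eq_zero]
      intro y hy
      obtain ⟨i, hi, rfl⟩ := List.mem_iff_getElem.1 hy
      rw [List.length_take] at hi
      rw [List.getElem_take]
      simpa using (hl.getElem_le_getElem_of_le (by omega)).trans hx
    rw [← List.take_append_drop (l.length - j + 1) l, List.countP_append, h, zero_add]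
    refine List.countP_le_length.trans_lt ?_
    rw [List.length_drop]
    omega

/-- The number of coordinates of `v` exceeding `x`. -/
noncomputable def exceedCount {t : ℕ} (x : ℝ) (v : Fin t → ℝ) : ℕ := ∑ i, Set.indicator {y | x < y} 1 (v i)

lemma countP_ofFn_eq_exceedCount {t : ℕ} (x : ℝ) (v : Fin t → ℝ) :
    (List.ofFn v).countP (fun y => decide (x < y)) = exceedCount x v := by
  induction t with
  | zero => simp [exceedCount]
  | succ t ih =>
    rw [List.ofFn_succ, List.countP_cons, ih, exceedCount, exceedCount, Fin.sum_univ_succ, add_comm]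
    simp [Set.indicator_apply]

lemma lt_orderStat_iff {t j : ℕ} (hj : 1 ≤ j) (hjt : j ≤ t) (v : Fin t → ℝ) (x : ℝ) :
    x < orderStat t j v ↔ j ≤ exceedCount x v := by
  have hlen : ((List.ofFn v).insertionSort (· ≤ ·)).length = t := by simp
  have h := lt_getElem_iff_le_countP (List.sortedLE_insertionSort (l := List.ofFn v)) hj
    (by omega) x
  rw [(List.perm_insertionSort _ _).countP_eq, countP_ofFn_eq_exceedCount] at h
  rw [← h, orderStat, List.getD_eq_getElem _ _ (by omega)]
  simp only [hlen]

lemma exists_eq_orderStat {t j : ℕ} (hj : 1 ≤ j) (hjt : j ≤ t) (v : Fin t → ℝ) :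
    ∃ i, v i = orderStat t j v := by
  have hlen : ((List.ofFn v).insertionSort (· ≤ ·)).length = t := by simp
  have h : orderStat t j v ∈ (List.ofFn v).insertionSort (· ≤ ·) := by
    rw [orderStat, List.getD_eq_getElem _ _ (by omega)]
    exact List.getElem_mem _
  simpa [List.mem_ofFn] using h

lemma measurable_exceedCount {t : ℕ} (x : ℝ) :
    Measurable (exceedCount x : (Fin t → ℝ) → ℕ) :=
  Finset.measurable_sum _ fun i _ =>
    (measurable_one.indicator measurableSet_Ioi).comp (measurable_pi_apply i)

lemma measurable_orderStat {t j : ℕ} (hj : 1 ≤ j) (hjt : j ≤ t) :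
    Measurable (orderStat t j) := by
  refine measurable_of_Ioi fun x => ?_
  have : orderStat t j ⁻¹' Set.Ioi x = exceedCount x ⁻¹' Set.Ici j := by
    ext v
    exact lt_orderStat_iff hj hjt v x
  rw [this]
  exact measurable_exceedCount x measurableSet_Ici

lemma orderStat_one_le_iff {t : ℕ} (ht : 1 ≤ t) (v : Fin t → ℝ) (x : ℝ) :
    orderStat t 1 v ≤ x ↔ ∀ i, v i ≤ x := by
  rw [← not_lt, lt_orderStat_iff le_rfl ht, exceedCount]
  simp [Set.indicator_apply]

lemma integrable_orderStat {μ : Measure ℝ} [IsProbabilityMeasure μ] (hμ : Integrable id μ)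
    {t j : ℕ} (hj : 1 ≤ j) (hjt : j ≤ t) :
    Integrable (orderStat t j) (Measure.pi fun _ : Fin t => μ) := by
  have hi : ∀ i : Fin t, Integrable (fun v : Fin t → ℝ => v i) (Measure.pi fun _ => μ) := fun i =>
    (measurePreserving_eval (fun _ : Fin t => μ) i).integrable_comp_of_integrable hμ
  refine Integrable.mono' (integrable_finsetSum Finset.univ fun i _ => (hi i).abs)
    (measurable_orderStat hj hjt).aestronglyMeasurable (Eventually.of_forall fun v => ?_)
  obtain ⟨i, hi⟩ := exists_eq_orderStat hj hjt v
  rw [← hi, Real.norm_eq_abs]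
  exact Finset.single_le_sum (f := fun i => |v i|) (fun i _ => abs_nonneg _) (Finset.mem_univ i)

lemma ae_orderStat {μ : Measure ℝ} [IsProbabilityMeasure μ] {P : ℝ → Prop} (h : ∀ᵐ y ∂μ, P y)
    {t j : ℕ} (hj : 1 ≤ j) (hjt : j ≤ t) :
    ∀ᵐ v ∂(Measure.pi fun _ : Fin t => μ), P (orderStat t j v) := by
  have : ∀ᵐ v ∂(Measure.pi fun _ : Fin t => μ), ∀ i, P (v i) :=
    eventually_all.2 fun i =>
      (measurePreserving_eval (fun _ : Fin t => μ) i).quasiMeasurePreserving.ae h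
  filter_upwards [this] with v hv
  obtain ⟨i, hi⟩ := exists_eq_orderStat hj hjt v
  exact hi ▸ hv i

/-- Integrability of the maximum of nonnegative draws passes to a single draw. -/
lemma integrable_id_of_integrable_orderStat {μ : Measure ℝ} [IsProbabilityMeasure μ]
    (h0 : ∀ᵐ y ∂μ, 0 ≤ y) {n : ℕ} (hn : 1 ≤ n)
    (hint : Integrable (orderStat n 1) (Measure.pi fun _ : Fin n => μ)) : Integrable id μ := by
  have hmp := measurePreserving_eval (fun _ : Fin n => μ) ⟨0, hn⟩
  rw [← hmp.integrable_comp aestronglyMeasurable_id]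
  refine hint.mono' (measurable_pi_apply _).aestronglyMeasurable ?_
  filter_upwards [hmp.quasiMeasurePreserving.ae h0] with v hv
  simp only [Function.comp, id, Function.eval] at hv ⊢
  rw [Real.norm_of_nonneg hv]
  exact (orderStat_one_le_iff hn v _).1 le_rfl _

lemma map_orderStat_one_Iic {μ : Measure ℝ} [IsProbabilityMeasure μ] {t : ℕ} (ht : 1 ≤ t) (x : ℝ) :
    (Measure.pi fun _ : Fin t => μ).map (orderStat t 1) (Set.Iic x) = μ (Set.Iic x) ^ t := by
  rw [Measure.map_apply (measurable_orderStat le_rfl ht) measurableSet_Iic]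
  have : orderStat t 1 ⁻¹' Set.Iic x = Set.univ.pi fun _ : Fin t => Set.Iic x := by
    ext v
    simp [orderStat_one_le_iff ht, Pi.le_def]
  rw [this, Measure.pi_pi]
  simp

lemma ofReal_orderStatExp {μ : Measure ℝ} [IsProbabilityMeasure μ] (h0 : ∀ᵐ y ∂μ, 0 ≤ y)
    (hμ : Integrable id μ) {t j : ℕ} (hj : 1 ≤ j) (hjt : j ≤ t) :
    ENNReal.ofReal (orderStatExp μ j t) =
      ∫⁻ x in Set.Ioi 0, (Measure.pi fun _ : Fin t => μ) {v | x < orderStat t j v} := by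
  have hnn := ae_orderStat h0 hj hjt
  rw [orderStatExp, ofReal_integral_eq_lintegral_ofReal (integrable_orderStat hμ hj hjt) hnn,
    lintegral_eq_lintegral_meas_lt _ hnn (measurable_orderStat hj hjt).aemeasurable]

lemma orderStatExp_nonneg {μ : Measure ℝ} [IsProbabilityMeasure μ] (h0 : ∀ᵐ y ∂μ, 0 ≤ y)
    {t j : ℕ} (hj : 1 ≤ j) (hjt : j ≤ t) : 0 ≤ orderStatExp μ j t :=
  integral_nonneg_of_ae (ae_orderStat h0 hj hjt)

lemma measurableSet_lt_orderStat {t j : ℕ} (hj : 1 ≤ j) (hjt : j ≤ t) (x : ℝ) :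
    MeasurableSet {v | x < orderStat t j v} :=
  measurable_orderStat hj hjt measurableSet_Ioi

/-- On average, at most `min k (n * μ (Ioi x))` of the top `k` order statistics exceed `x`. -/
lemma sum_measureReal_lt_orderStat_le {μ : Measure ℝ} [IsProbabilityMeasure μ] {n k : ℕ}
    (hkn : k ≤ n) (x : ℝ) :
    ∑ j ∈ Finset.Icc 1 k, (Measure.pi fun _ : Fin n => μ).real {v | x < orderStat n j v} ≤
      min (k : ℝ) (n * μ.real (Set.Ioi x)) := by
  refine le_min ?_ ?_
  · calc _ ≤ ∑ j ∈ Finset.Icc 1 k, (1 : ℝ) := Finset.sum_le_sum fun j _ => measureReal_le_one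
      _ = k := by simp
  · have hind : ∀ i : Fin n, Integrable (fun v : Fin n → ℝ => (Set.Ioi x).indicator (1 : ℝ → ℝ) (v i))
        (Measure.pi fun _ => μ) := fun i =>
      (measurePreserving_eval (fun _ : Fin n => μ) i).integrable_comp_of_integrable
        ((integrable_const (1 : ℝ)).indicator measurableSet_Ioi)
    calc _ = ∑ j ∈ Finset.Icc 1 k, ∫ v, Set.indicator {v | x < orderStat n j v} (1 : (Fin n → ℝ) → ℝ) v
          ∂(Measure.pi fun _ : Fin n => μ) := by
          refine Finset.sum_congr rfl fun j hj => ?_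
          rw [Finset.mem_Icc] at hj
          rw [integral_indicator_one (measurableSet_lt_orderStat hj.1 (hj.2.trans hkn) x)]
      _ = ∫ v, ∑ j ∈ Finset.Icc 1 k, Set.indicator {v | x < orderStat n j v} (1 : (Fin n → ℝ) → ℝ) v
          ∂(Measure.pi fun _ : Fin n => μ) := by
          rw [integral_finsetSum]
          intro j hj
          rw [Finset.mem_Icc] at hj
          exact (integrable_const (1 : ℝ)).indicator
            (measurableSet_lt_orderStat hj.1 (hj.2.trans hkn) x)
      _ ≤ ∫ v, ∑ i, (Set.Ioi x).indicator (1 : ℝ → ℝ) (v i) ∂(Measure.pi fun _ : Fin n => μ) := by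
          refine integral_mono (integrable_finsetSum _ fun j hj => ?_)
            (integrable_finsetSum _ fun i _ => hind i) fun v => ?_
          · rw [Finset.mem_Icc] at hj
            exact (integrable_const (1 : ℝ)).indicator
              (measurableSet_lt_orderStat hj.1 (hj.2.trans hkn) x)
          · have h1 : ∑ j ∈ Finset.Icc 1 k,
                Set.indicator {v | x < orderStat n j v} (1 : (Fin n → ℝ) → ℝ) v =
                ((Finset.Icc 1 k).filter (· ≤ exceedCount x v)).card := by
              rw [Finset.card_filter, Nat.cast_sum]
              refine Finset.sum_congr rfl fun j hj => ?_
              rw [Finset.mem_Icc] at hj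
              simp [Set.indicator_apply, lt_orderStat_iff hj.1 (hj.2.trans hkn)]
            have h2 : ∑ i, (Set.Ioi x).indicator (1 : ℝ → ℝ) (v i) = exceedCount x v := by
              rw [exceedCount, Nat.cast_sum]
              refine Finset.sum_congr rfl fun i _ => ?_
              simp [Set.indicator_apply]
            simp only [h1, h2, Nat.cast_le]
            calc _ ≤ (Finset.Icc 1 (exceedCount x v)).card := by
                  refine Finset.card_le_card fun j hj => ?_
                  simp only [Finset.mem_filter, Finset.mem_Icc] at hj ⊢
                  exact ⟨hj.1.1, hj.2⟩
              _ = _ := by simp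
      _ = n * μ.real (Set.Ioi x) := by
          rw [integral_finsetSum _ fun i _ => hind i]
          have : ∀ i : Fin n, ∫ v, (Set.Ioi x).indicator (1 : ℝ → ℝ) (v i)
              ∂(Measure.pi fun _ : Fin n => μ) = μ.real (Set.Ioi x) := fun i => by
            rw [← integral_indicator_one measurableSet_Ioi]
            exact integral_comp_eval (μ := fun _ : Fin n => μ)
              (measurable_one.indicator measurableSet_Ioi).aestronglyMeasurable
          simp [this]

/-- The scalar correlation-gap inequality. -/
lemma one_sub_exp_neg_one_mul_min_le {n k s : ℕ} (hk : 1 ≤ k) (hns : n ≤ k * s) {z : ℝ}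
    (hz0 : 0 ≤ z) (hz1 : z ≤ 1) :
    (1 - 1 / Real.exp 1) * min (k : ℝ) (n * z) ≤ k * (1 - (1 - z) ^ s) := by
  have hk0 : (0 : ℝ) < k := by exact_mod_cast hk
  have hns' : (n : ℝ) ≤ k * s := by exact_mod_cast hns
  set m := min (k : ℝ) (n * z)
  have hm0 : 0 ≤ m / k := div_nonneg (le_min hk0.le (by positivity)) hk0.le
  have hm1 : m / k ≤ 1 := (div_le_one hk0).2 (min_le_left _ _)
  have hms : m / k ≤ s * z := by
    rw [div_le_iff₀ hk0]
    calc m ≤ n * z := min_le_right _ _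
      _ ≤ k * s * z := by gcongr
      _ = _ := by ring
  have hpow : (1 - z) ^ s ≤ Real.exp (-(m / k)) := by
    calc (1 - z) ^ s ≤ Real.exp (-z) ^ s := by
          have := Real.one_sub_le_exp_neg z
          gcongr
      _ = Real.exp (-(s * z)) := by rw [← Real.exp_nat_mul]; ring_nf
      _ ≤ _ := by gcongr
  have hconv : Real.exp (-(m / k)) ≤ (1 - m / k) * 1 + (m / k) * (1 / Real.exp 1) := by
    have := convexOn_exp.2 (Set.mem_univ (0 : ℝ)) (Set.mem_univ (-1 : ℝ))
      (sub_nonneg.2 hm1) hm0 (by ring)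
    simpa [Real.exp_neg, ← Real.exp_neg] using this
  have : (1 - 1 / Real.exp 1) * (m / k) ≤ 1 - (1 - z) ^ s := by linarith
  calc (1 - 1 / Real.exp 1) * m = k * ((1 - 1 / Real.exp 1) * (m / k)) := by field_simp
    _ ≤ _ := by gcongr

lemma measureReal_lt_orderStat_one {μ : Measure ℝ} [IsProbabilityMeasure μ] {s : ℕ} (hs : 1 ≤ s)
    (x : ℝ) : (Measure.pi fun _ : Fin s => μ).real {v | x < orderStat s 1 v} =
      1 - (1 - μ.real (Set.Ioi x)) ^ s := by
  have h : (Measure.pi fun _ : Fin s => μ).real {v | x < orderStat s 1 v}ᶜ =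
      μ.real (Set.Iic x) ^ s := by
    have h1 := map_orderStat_one_Iic (μ := μ) hs x
    rw [Measure.map_apply (measurable_orderStat le_rfl hs) measurableSet_Iic] at h1
    have h2 : {v | x < orderStat s 1 v}ᶜ = orderStat s 1 ⁻¹' Set.Iic x := by ext; simp
    rw [Measure.real, h2, h1, ENNReal.toReal_pow, Measure.real]
  rw [probReal_compl_eq_one_sub (measurableSet_lt_orderStat le_rfl hs x)] at h
  have h3 := probReal_compl_eq_one_sub (μ := μ) (measurableSet_Ioi (a := x))
  rw [Set.compl_Ioi] at h3
  rw [← h3]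
  linarith

/-- Correlation gap: `k` times the expected maximum of `s ≥ n / k` draws is at least `1 - 1/e`
times the expected sum of the `k` largest of `n` draws. -/
theorem sum_orderStatExp_le {μ : Measure ℝ} [IsProbabilityMeasure μ] (h0 : ∀ᵐ y ∂μ, 0 ≤ y)
    (hμ : Integrable id μ) {n k s : ℕ} (hk : 1 ≤ k) (hkn : k ≤ n) (hs : 1 ≤ s) (hns : n ≤ k * s) :
    (1 - 1 / Real.exp 1) * ∑ j ∈ Finset.Icc 1 k, orderStatExp μ j n ≤ k * orderStatExp μ 1 s := by
  have he : 0 ≤ 1 - 1 / Real.exp 1 := by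
    rw [sub_nonneg, div_le_one (Real.exp_pos 1)]
    exact Real.one_le_exp zero_le_one
  have hj : ∀ j ∈ Finset.Icc 1 k, 1 ≤ j ∧ j ≤ n := fun j hj => by
    rw [Finset.mem_Icc] at hj
    omega
  rw [← ENNReal.ofReal_le_ofReal_iff
      (mul_nonneg k.cast_nonneg (orderStatExp_nonneg h0 le_rfl hs)),
    ENNReal.ofReal_mul he, ENNReal.ofReal_mul k.cast_nonneg,
    ENNReal.ofReal_sum_of_nonneg fun j h => orderStatExp_nonneg h0 (hj j h).1 (hj j h).2,
    Finset.sum_congr rfl fun j h => ofReal_orderStatExp h0 hμ (hj j h).1 (hj j h).2,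
    ofReal_orderStatExp h0 hμ le_rfl hs]
  have hmeas : ∀ t j : ℕ, Measurable fun x : ℝ =>
      (Measure.pi fun _ : Fin t => μ) {v | x < orderStat t j v} := fun t j =>
    Antitone.measurable fun x y hxy => measure_mono fun v hv => lt_of_le_of_lt hxy hv
  rw [← lintegral_finsetSum _ fun j _ => hmeas n j,
    ← lintegral_const_mul _ (Finset.measurable_sum _ fun j _ => hmeas n j),
    ← lintegral_const_mul _ (hmeas s 1)]
  refine lintegral_mono fun x => ?_
  have hreal : (1 - 1 / Real.exp 1) * ∑ j ∈ Finset.Icc 1 k,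
      (Measure.pi fun _ : Fin n => μ).real {v | x < orderStat n j v} ≤
      k * (Measure.pi fun _ : Fin s => μ).real {v | x < orderStat s 1 v} := by
    rw [measureReal_lt_orderStat_one hs]
    exact (mul_le_mul_of_nonneg_left (sum_measureReal_lt_orderStat_le hkn x) he).trans
      (one_sub_exp_neg_one_mul_min_le hk hns measureReal_nonneg measureReal_le_one)
  have := ENNReal.ofReal_le_ofReal hreal
  rw [ENNReal.ofReal_mul he, ENNReal.ofReal_mul k.cast_nonneg,
    ENNReal.ofReal_sum_of_nonneg fun j _ => measureReal_nonneg] at this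
  simpa only [Measure.real, ENNReal.ofReal_toReal (measure_ne_top _ _)] using this

lemma pow_mul_geom_sum_sq_le (m : ℕ) {u w : ℝ} (hu : 0 ≤ u) (huw : u ≤ w) (hw : w ≤ 1) :
    u ^ m * ∑ i ∈ Finset.range (m + 1), (w ^ 2) ^ i ≤
      w ^ m * ∑ i ∈ Finset.range (m + 1), (u ^ 2) ^ i := by
  have hw0 := hu.trans huw
  have key : ∀ d : ℕ, u ^ d * (1 + (w ^ 2) ^ d) ≤ w ^ d * (1 + (u ^ 2) ^ d) := fun d => by
    have h1 : u ^ d ≤ w ^ d := by gcongr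
    have h2 : u ^ d * w ^ d ≤ 1 :=
      mul_le_one₀ (pow_le_one₀ hu (huw.trans hw)) (by positivity) (pow_le_one₀ hw0 hw)
    rw [← pow_mul, ← pow_mul, mul_comm 2 d, pow_mul, pow_mul]
    nlinarith [mul_nonneg (sub_nonneg.2 h1) (sub_nonneg.2 h2)]
  induction m using Nat.twoStepInduction with
  | zero => simp
  | one => simpa [Finset.sum_range_succ] using key 1
  | more m ih _ =>
    have split : ∀ x : ℝ, ∑ i ∈ Finset.range (m + 2 + 1), x ^ i =
        (1 + x ^ (m + 2)) + x * ∑ i ∈ Finset.range (m + 1), x ^ i := fun x => by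
      rw [Finset.sum_range_succ, Finset.sum_range_succ', Finset.mul_sum]
      simp only [pow_succ', pow_zero]
      ring
    rw [split, split, mul_add (u ^ _), mul_add (w ^ _)]
    refine add_le_add (key _) ?_
    calc u ^ (m + 2) * (w ^ 2 * ∑ i ∈ Finset.range (m + 1), (w ^ 2) ^ i)
        = u ^ 2 * w ^ 2 * (u ^ m * ∑ i ∈ Finset.range (m + 1), (w ^ 2) ^ i) := by ring
      _ ≤ u ^ 2 * w ^ 2 * (w ^ m * ∑ i ∈ Finset.range (m + 1), (u ^ 2) ^ i) := by gcongr
      _ = _ := by ring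

lemma monotoneOn_pow_div_geom_sum_rpow (m : ℕ) {l : ℝ} (hl1 : l ≤ 1) :
    MonotoneOn (fun x : ℝ => x ^ m / (∑ i ∈ Finset.range (m + 1), x ^ i) ^ (1 + l))
      (Set.Icc 0 1) := by
  intro x hx y hy hxy
  have hpos : ∀ z : ℝ, 0 ≤ z → 0 < ∑ i ∈ Finset.range (m + 1), z ^ i := fun z hz => by
    rw [Finset.sum_range_succ']
    have : 0 ≤ ∑ i ∈ Finset.range m, z ^ (i + 1) := Finset.sum_nonneg fun i _ => by positivity
    simp only [pow_zero]
    linarith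
  have hSx := hpos x hx.1
  have hSy := hpos y hy.1
  have hS : ∑ i ∈ Finset.range (m + 1), x ^ i ≤ ∑ i ∈ Finset.range (m + 1), y ^ i :=
    Finset.sum_le_sum fun i _ => pow_le_pow_left₀ hx.1 hxy i
  have hsq := pow_mul_geom_sum_sq_le m (Real.sqrt_nonneg x) (Real.sqrt_le_sqrt hxy)
    (Real.sqrt_le_one.2 hy.2)
  rw [Real.sq_sqrt hx.1, Real.sq_sqrt hy.1] at hsq
  have hsq' := pow_le_pow_left₀ (by positivity) hsq 2
  rw [mul_pow, mul_pow, ← pow_mul, ← pow_mul, mul_comm m 2, pow_mul, pow_mul, Real.sq_sqrt hx.1,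
    Real.sq_sqrt hy.1] at hsq'
  simp only
  generalize ∑ i ∈ Finset.range (m + 1), x ^ i = S at *
  generalize ∑ i ∈ Finset.range (m + 1), y ^ i = T at *
  have hsplit : ∀ z : ℝ, 0 < z → z ^ 2 = z ^ (1 + l) * z ^ (1 - l) := fun z hz => by
    rw [← Real.rpow_add hz, ← Real.rpow_natCast]
    norm_num
  have hST : S ^ (1 - l) ≤ T ^ (1 - l) := by
    apply Real.rpow_le_rpow hSx.le hS
    linarith
  have hTp := Real.rpow_pos_of_pos hSy (1 - l)
  have hy0 := hy.1
  rw [div_le_div_iff₀ (by positivity) (by positivity)]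
  refine le_of_mul_le_mul_right ?_ hTp
  calc x ^ m * T ^ (1 + l) * T ^ (1 - l) = x ^ m * T ^ 2 := by rw [hsplit T hSy]; ring
    _ ≤ y ^ m * S ^ 2 := hsq'
    _ = y ^ m * S ^ (1 + l) * S ^ (1 - l) := by rw [hsplit S hSx]; ring
    _ ≤ y ^ m * S ^ (1 + l) * T ^ (1 - l) := by gcongr

/-- The class of `λ`-regular distributions, expressed through monotonicity of
`f / (1 - F) ^ (1 + λ)`, is closed under taking the maximum of `m + 1` draws. -/
lemma monotoneOn_density_pow {I : Set ℝ} {F f : ℝ → ℝ} {l : ℝ} (hl1 : l ≤ 1)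
    (hF : ∀ x ∈ I, F x ∈ Set.Ico 0 1) (hFm : MonotoneOn F I) (hf : ∀ x ∈ I, 0 < f x)
    (h : MonotoneOn (fun x => f x / (1 - F x) ^ (1 + l)) I) (m : ℕ) :
    MonotoneOn (fun x => ((m + 1 : ℕ) * F x ^ m * f x) / (1 - F x ^ (m + 1)) ^ (1 + l)) I := by
  have heq : ∀ x ∈ I, ((m + 1 : ℕ) * F x ^ m * f x) / (1 - F x ^ (m + 1)) ^ (1 + l) =
      (m + 1 : ℕ) * ((f x / (1 - F x) ^ (1 + l)) *
        (F x ^ m / (∑ i ∈ Finset.range (m + 1), F x ^ i) ^ (1 + l))) := fun x hx => by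
    have hx' := hF x hx
    rw [← mul_neg_geom_sum, Real.mul_rpow (by linarith [hx'.2])
      (Finset.sum_nonneg fun i _ => pow_nonneg hx'.1 i), div_mul_div_comm]
    ring
  intro x hx y hy hxy
  simp only
  rw [heq x hx, heq y hy]
  have hx' := hF x hx
  have hy' := hF y hy
  have := h hx hy hxy
  have := monotoneOn_pow_div_geom_sum_rpow m hl1 (Set.Ico_subset_Icc_self hx')
    (Set.Ico_subset_Icc_self hy') (hFm hx hy hxy)
  have hS : 0 ≤ ∑ i ∈ Finset.range (m + 1), F x ^ i :=
    Finset.sum_nonneg fun i _ => pow_nonneg hx'.1 i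
  have h1 := hf y hy
  have h2 : 0 < 1 - F y := by linarith [hy'.2]
  have h3 := hx'.1
  gcongr

lemma monotoneOn_density_div_rpow {I : Set ℝ} (hI : I.OrdConnected) {F f : ℝ → ℝ} {l : ℝ}
    (hl0 : 0 ≤ l) (hF : ∀ x ∈ I, F x < 1) (hd : ∀ x ∈ I, HasDerivAt F (f x) x)
    (hf : ∀ x ∈ I, 0 < f x) (hreg : MonotoneOn (fun v => l * v - (1 - F v) / f v) I) :
    MonotoneOn (fun x => f x / (1 - F x) ^ (1 + l)) I := by
  intro v hv w hw hvw
  have hsub : Set.Icc v w ⊆ I := hI.out hv hw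
  have hA : ∀ x ∈ I, 0 < (1 - F x) / f x := fun x hx => div_pos (by linarith [hF x hx]) (hf x hx)
  have hL : ∀ x ∈ Set.Icc v w, (1 - F x) / f x ≤ (1 - F v) / f v + l * (x - v) := fun x hx => by
    have := hreg hv (hsub hx) hx.1
    simp only at this
    linarith
  have hLpos : ∀ x ∈ Set.Icc v w, 0 < (1 - F v) / f v + l * (x - v) := fun x hx =>
    (hA x (hsub hx)).trans_le (hL x hx)
  have hder : ∀ x ∈ Set.Icc v w,
      HasDerivAt (fun x => -l * Real.log (1 - F x) - Real.log ((1 - F v) / f v + l * (x - v)))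
        (-l * (-f x / (1 - F x)) - l / ((1 - F v) / f v + l * (x - v))) x := fun x hx => by
    have h1 := (((hd x (hsub hx)).const_sub 1).log (by linarith [hF x (hsub hx)])).const_mul (-l)
    have h2 := (((((hasDerivAt_id x).sub_const v).const_mul l).const_add
      ((1 - F v) / f v)).log (hLpos x hx).ne')
    rw [mul_one] at h2
    exact h1.sub h2
  have hmono := monotoneOn_of_hasDerivWithinAt_nonneg (convex_Icc v w)
    (fun x hx => (hder x hx).continuousAt.continuousWithinAt)
    (fun x hx => (hder x (interior_subset hx)).hasDerivWithinAt) fun x hx => by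
      have hx := interior_subset hx
      have h1 : l / ((1 - F v) / f v + l * (x - v)) ≤ l / ((1 - F x) / f x) :=
        div_le_div_of_nonneg_left hl0 (hA x (hsub hx)) (hL x hx)
      rw [div_div_eq_mul_div] at h1
      have h2 : -l * (-f x / (1 - F x)) = l * f x / (1 - F x) := by ring
      linarith
  have h1 := hmono (Set.left_mem_Icc.2 hvw) (Set.right_mem_Icc.2 hvw) hvw
  have h2 := Real.log_le_log (hA w hw) (hL w (Set.right_mem_Icc.2 hvw))
  have hlog : ∀ x ∈ I, Real.log (f x / (1 - F x) ^ (1 + l)) =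
      -l * Real.log (1 - F x) - Real.log ((1 - F x) / f x) := fun x hx => by
    have hpos : 0 < 1 - F x := by linarith [hF x hx]
    rw [Real.log_div (hf x hx).ne' (by positivity), Real.log_rpow hpos,
      Real.log_div hpos.ne' (hf x hx).ne']
    ring
  have hpos : ∀ x ∈ I, 0 < f x / (1 - F x) ^ (1 + l) := fun x hx =>
    div_pos (hf x hx) (Real.rpow_pos_of_pos (by linarith [hF x hx]) _)
  rw [← Real.log_le_log_iff (hpos v hv) (hpos w hw), hlog v hv, hlog w hw]
  simp only [sub_self, mul_zero, add_zero] at h1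
  linarith

lemma tangent_le_of_monotoneOn_deriv {I : Set ℝ} (hI : I.OrdConnected) {H h : ℝ → ℝ}
    (hd : ∀ x ∈ I, HasDerivAt H (h x) x) (hm : MonotoneOn h I) {p v : ℝ} (hp : p ∈ I)
    (hv : v ∈ I) : H p + h p * (v - p) ≤ H v := by
  rcases lt_trichotomy p v with hlt | rfl | hlt
  · have hsub : Set.Icc p v ⊆ I := hI.out hp hv
    obtain ⟨c, hc, hc'⟩ := exists_hasDerivAt_eq_slope H h hlt
      (fun x hx => (hd x (hsub hx)).continuousAt.continuousWithinAt)
      fun x hx => hd x (hsub (Set.Ioo_subset_Icc_self hx))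
    have h1 := hm hp (hsub (Set.Ioo_subset_Icc_self hc)) hc.1.le
    rw [hc', le_div_iff₀ (by linarith)] at h1
    linarith
  · simp
  · have hsub : Set.Icc v p ⊆ I := hI.out hv hp
    obtain ⟨c, hc, hc'⟩ := exists_hasDerivAt_eq_slope H h hlt
      (fun x hx => (hd x (hsub hx)).continuousAt.continuousWithinAt)
      fun x hx => hd x (hsub (Set.Ioo_subset_Icc_self hx))
    have h1 := hm (hsub (Set.Ioo_subset_Icc_self hc)) hp hc.2.le
    rw [hc', div_le_iff₀ (by linarith)] at h1
    linarith

/-- The probability integral transform. -/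
lemma map_cdf_eq_uniform {ν : Measure ℝ} [IsProbabilityMeasure ν] {G : ℝ → ℝ} {I : Set ℝ}
    (hGm : Measurable G) (hI : ∀ᵐ x ∂ν, x ∈ I) (hG : StrictMonoOn G I)
    (hν : ∀ x ∈ I, ν (Set.Iic x) = ENNReal.ofReal (G x)) (hmaps : Set.MapsTo G I (Set.Ico 0 1))
    (hsurj : Set.SurjOn G I (Set.Ico 0 1)) : ν.map G = volume.restrict (Set.Icc 0 1) := by
  have := Measure.isProbabilityMeasure_map (μ := ν) hGm.aemeasurable
  refine Measure.ext_of_Iic _ _ fun y => ?_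
  have hR : (volume.restrict (Set.Icc (0 : ℝ) 1)) (Set.Iic y) = ENNReal.ofReal (min y 1) := by
    rw [Measure.restrict_apply measurableSet_Iic]
    have : Set.Iic y ∩ Set.Icc 0 1 = Set.Icc 0 (min y 1) := by
      ext z
      simp only [Set.mem_inter_iff, Set.mem_Iic, Set.mem_Icc, le_min_iff]
      tauto
    rw [this, Real.volume_Icc, sub_zero]
  rw [hR, Measure.map_apply hGm measurableSet_Iic]
  rcases lt_or_ge y 0 with hy | hy
  · rw [min_eq_left (by linarith), ENNReal.ofReal_of_nonpos hy.le, measure_eq_zero_iff_ae_notMem]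
    filter_upwards [hI] with x hx hxy
    exact absurd (hmaps hx).1 (not_le.2 (lt_of_le_of_lt hxy hy))
  rcases lt_or_ge y 1 with hy1 | hy1
  · obtain ⟨x, hx, rfl⟩ := hsurj ⟨hy, hy1⟩
    rw [min_eq_left hy1.le, ← hν x hx]
    refine measure_congr ?_
    filter_upwards [hI] with z hz
    exact propext (hG.le_iff_le hz hx)
  · rw [min_eq_right hy1, ENNReal.ofReal_one, ← prob_compl_eq_zero_iff (hGm measurableSet_Iic),
      measure_eq_zero_iff_ae_notMem]
    filter_upwards [hI] with x hx hxy
    exact hxy ((hmaps hx).2.le.trans hy1)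

/-- Jensen's inequality for `K ∘ G`, where `G` is the CDF of `ν`. -/
lemma comp_cdf_mean_le_integral {ν : Measure ℝ} [IsProbabilityMeasure ν] {G : ℝ → ℝ} {I : Set ℝ}
    (hGm : Measurable G) (hI : ∀ᵐ x ∂ν, x ∈ I) (hIc : I.OrdConnected)
    (hU : ν.map G = volume.restrict (Set.Icc 0 1)) (hint : Integrable id ν)
    (hp : ∫ x, x ∂ν ∈ I) {K h : ℝ → ℝ} (hKi : IntegrableOn K (Set.Icc 0 1))
    (hd : ∀ x ∈ I, HasDerivAt (fun x => K (G x)) (h x) x) (hm : MonotoneOn h I) :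
    K (G (∫ x, x ∂ν)) ≤ ∫ y in (0 : ℝ)..1, K y := by
  set p := ∫ x, x ∂ν with hp_def
  rw [intervalIntegral.integral_of_le zero_le_one, ← integral_Icc_eq_integral_Ioc, ← hU,
    integral_map hGm.aemeasurable (hU ▸ hKi.aestronglyMeasurable)]
  have hKG : Integrable (fun x => K (G x)) ν := by
    rw [IntegrableOn, ← hU] at hKi
    exact hKi.comp_measurable hGm
  have hlin : Integrable (fun x => h p * (x - p)) ν :=
    (hint.sub (integrable_const p)).const_mul _
  have hid : Integrable (fun x : ℝ => x) ν := hint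
  calc K (G p) = ∫ x, (K (G p) + h p * (x - p)) ∂ν := by
        rw [integral_add (integrable_const _) hlin, integral_const_mul,
          integral_sub hid (integrable_const p)]
        simp [← hp_def]
    _ ≤ ∫ x, K (G x) ∂ν := by
        refine integral_mono_ae ((integrable_const _).add hlin) hKG ?_
        filter_upwards [hI] with x hx
        exact tangent_le_of_monotoneOn_deriv (H := fun x => K (G x)) hIc hd hm hp hx

lemma cReg_nonneg {l : ℝ} (hl1 : l ≤ 1) : 0 ≤ cReg l := by
  unfold cReg
  split_ifs
  · positivity
  · exact Real.rpow_nonneg (by linarith) _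

lemma intervalIntegrable_one_sub_rpow {r : ℝ} (hr : -1 < r) :
    IntervalIntegrable (fun y : ℝ => (1 - y) ^ r) volume 0 1 := by
  simpa using (intervalIntegral.intervalIntegrable_rpow' (a := 1) (b := 0) hr).comp_sub_left 1

/-- A `λ`-regular random variable exceeds its mean with probability at least `c(λ)`. -/
theorem cReg_le_one_sub_cdf_mean {ν : Measure ℝ} [IsProbabilityMeasure ν] {G g : ℝ → ℝ}
    {I : Set ℝ} {l : ℝ} (hl0 : 0 ≤ l) (hl1 : l < 1)
    (hGm : Measurable G) (hI : ∀ᵐ x ∂ν, x ∈ I) (hIc : I.OrdConnected)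
    (hU : ν.map G = volume.restrict (Set.Icc 0 1)) (hint : Integrable id ν)
    (hp : ∫ x, x ∂ν ∈ I) (hG : ∀ x ∈ I, G x < 1) (hd : ∀ x ∈ I, HasDerivAt G (g x) x)
    (hm : MonotoneOn (fun x => g x / (1 - G x) ^ (1 + l)) I) :
    cReg l ≤ 1 - G (∫ x, x ∂ν) := by
  have hpos : ∀ x ∈ I, 0 < 1 - G x := fun x hx => by linarith [hG x hx]
  have hp1 := hpos _ hp
  rcases hl0.eq_or_lt with rfl | hl
  · have hKi : IntervalIntegrable (fun y : ℝ => -Real.log (1 - y)) volume 0 1 := by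
      have := (intervalIntegral.intervalIntegrable_log' (a := 1) (b := 0)).comp_sub_left 1
      rw [sub_self, sub_zero] at this
      exact this.neg
    have h := comp_cdf_mean_le_integral hGm hI hIc hU hint hp (K := fun y => -Real.log (1 - y))
      (h := fun x => g x / (1 - G x))
      (by rwa [integrableOn_Icc_iff_integrableOn_Ioc,
        ← intervalIntegrable_iff_integrableOn_Ioc_of_le zero_le_one])
      (fun x hx => by
        have := (((hd x hx).const_sub 1).log (hpos x hx).ne').neg
        rwa [neg_div, neg_neg] at this) (by simpa using hm)
    have hval : ∫ y in (0 : ℝ)..1, -Real.log (1 - y) = 1 := by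
      rw [intervalIntegral.integral_neg, intervalIntegral.integral_comp_sub_left Real.log 1]
      simp
    rw [hval] at h
    rw [cReg, if_pos rfl, ← Real.exp_neg, ← Real.le_log_iff_exp_le hp1]
    linarith
  · have hl2 : (0 : ℝ) < 1 - l := by linarith
    have h := comp_cdf_mean_le_integral hGm hI hIc hU hint hp (K := fun y => (1 - y) ^ (-l))
      (h := fun x => l * (g x / (1 - G x) ^ (1 + l)))
      (by
        rw [integrableOn_Icc_iff_integrableOn_Ioc,
          ← intervalIntegrable_iff_integrableOn_Ioc_of_le zero_le_one]
        exact intervalIntegrable_one_sub_rpow (by linarith))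
      (fun x hx => by
        have := ((hd x hx).const_sub 1).rpow_const (p := -l) (Or.inl (hpos x hx).ne')
        convert this using 1
        rw [show -l - 1 = -(1 + l) by ring, Real.rpow_neg (hpos x hx).le]
        ring) (fun x hx y hy hxy => mul_le_mul_of_nonneg_left (hm hx hy hxy) hl.le)
    have hval : ∫ y in (0 : ℝ)..1, (1 - y) ^ (-l) = (1 - l)⁻¹ := by
      rw [intervalIntegral.integral_comp_sub_left (fun y => y ^ (-l)) 1, integral_rpow (by left; linarith)]
      rw [show -l + 1 = 1 - l by ring]
      simp [Real.zero_rpow hl2.ne']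
    rw [hval] at h
    simp only [Real.rpow_neg hp1.le] at h
    rw [inv_le_inv₀ (by positivity) hl2] at h
    rwa [cReg, if_neg hl.ne', one_div, Real.rpow_inv_le_iff_of_pos hl2.le hp1.le hl]

lemma ordConnected_support (a : ℝ) (b : EReal) :
    {x : ℝ | a ≤ x ∧ (x : EReal) < b}.OrdConnected :=
  ⟨fun _ hx _ hy _ hz =>
    ⟨hx.1.trans hz.1, (EReal.coe_le_coe_iff.2 hz.2).trans_lt hy.2⟩⟩

namespace IsCDF

variable {F f : ℝ → ℝ} {a : ℝ} {b : EReal}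

lemma exists_lt (hF : IsCDF F f a b) {y : ℝ} (hy : y < 1) :
    ∃ x : ℝ, (a ≤ x ∧ (x : EReal) < b) ∧ y < F x := by
  obtain ⟨hab, -, -, -, hlim⟩ := hF
  have h := hlim.eventually (eventually_gt_nhds hy)
  rw [eventually_comap] at h
  obtain ⟨l, hl, hlb⟩ := (mem_nhdsLT_iff_exists_Ioo_subset' hab).1 h
  obtain ⟨x, hx1, hx2⟩ := EReal.lt_iff_exists_real_btwn.1 (max_lt hl hab)
  exact ⟨x, ⟨EReal.coe_le_coe_iff.1 ((le_max_right _ _).trans hx1.le), hx2⟩,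
    hlb ⟨(le_max_left _ _).trans_lt hx1, hx2⟩ x rfl⟩

lemma strictMonoOn (hF : IsCDF F f a b) : StrictMonoOn F {x : ℝ | a ≤ x ∧ (x : EReal) < b} :=
  strictMonoOn_of_deriv_pos (ordConnected_support a b).convex
    (fun x hx => (hF.2.2.2.1 x hx.1 hx.2).1.continuousAt.continuousWithinAt) fun x hx => by
      have hx := interior_subset hx
      rw [(hF.2.2.2.1 x hx.1 hx.2).1.deriv]
      exact (hF.2.2.2.1 x hx.1 hx.2).2

lemma mapsTo (hF : IsCDF F f a b) :
    Set.MapsTo F {x : ℝ | a ≤ x ∧ (x : EReal) < b} (Set.Ico 0 1) := by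
  intro x hx
  refine ⟨hF.2.2.1 ▸ hF.2.1 hx.1, ?_⟩
  by_contra! h
  obtain ⟨y, hxy, hyb⟩ := EReal.lt_iff_exists_real_btwn.1 hx.2
  have hxy := EReal.coe_lt_coe_iff.1 hxy
  have hlt := hF.strictMonoOn hx ⟨hx.1.trans hxy.le, hyb⟩ hxy
  have hle : F y ≤ 1 := by
    obtain ⟨hab, hm, -, -, hlim⟩ := hF
    have hne : (comap (fun x : ℝ => (x : EReal)) (nhdsWithin b (Set.Iio b))).NeBot := by
      rw [comap_neBot_iff]
      intro t ht
      obtain ⟨l, hl, hlb⟩ := (mem_nhdsLT_iff_exists_Ioo_subset' hab).1 ht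
      obtain ⟨z, hz1, hz2⟩ := EReal.lt_iff_exists_real_btwn.1 hl
      exact ⟨z, hlb ⟨hz1, hz2⟩⟩
    refine ge_of_tendsto hlim ?_
    rw [eventually_comap]
    filter_upwards [mem_nhdsWithin_of_mem_nhds (Ioi_mem_nhds hyb)] with e he z hz
    subst hz
    exact hm (EReal.coe_lt_coe_iff.1 he).le
  linarith

lemma surjOn_pow (hF : IsCDF F f a b) {t : ℕ} (ht : t ≠ 0) :
    Set.SurjOn (fun x => F x ^ t) {x : ℝ | a ≤ x ∧ (x : EReal) < b} (Set.Ico 0 1) := by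
  intro y hy
  have hr : y ^ ((t : ℝ)⁻¹) < 1 := Real.rpow_lt_one hy.1 hy.2 (by positivity)
  obtain ⟨x, hx, hyx⟩ := hF.exists_lt hr
  have hcont : ContinuousOn F (Set.Icc a x) := fun z hz =>
    (hF.2.2.2.1 z hz.1 ((EReal.coe_le_coe_iff.2 hz.2).trans_lt hx.2)).1.continuousAt.continuousWithinAt
  obtain ⟨z, hz, hzy⟩ := intermediate_value_Icc hx.1 hcont
    ⟨hF.2.2.1 ▸ Real.rpow_nonneg hy.1 _, hyx.le⟩
  exact ⟨z, ⟨hz.1, (EReal.coe_le_coe_iff.2 hz.2).trans_lt hx.2⟩, by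
    simp only [hzy, Real.rpow_inv_natCast_pow hy.1 ht]⟩

end IsCDF

lemma InducedBy.ae_mem {μ : Measure ℝ} {F f : ℝ → ℝ} {a : ℝ} {b : EReal}
    (hμ : InducedBy μ F a b) (hF : IsCDF F f a b) : ∀ᵐ x ∂μ, a ≤ x ∧ (x : EReal) < b := by
  have := hμ.1
  have h1 : ∀ᵐ x ∂μ, x ∉ Set.Iic a := by
    rw [← measure_eq_zero_iff_ae_notMem, hμ.2 a le_rfl hF.1, hF.2.2.1, ENNReal.ofReal_zero]
  have h2 : ∀ᵐ x ∂μ, x ∉ {x : ℝ | b ≤ x} := by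
    rw [← measure_eq_zero_iff_ae_notMem]
    refine le_antisymm (ENNReal.le_of_forall_pos_le_add fun ε hε _ => ?_) zero_le
    obtain ⟨x, hx, hxε⟩ := hF.exists_lt (y := 1 - ε) (by simpa using hε)
    calc μ {x : ℝ | b ≤ x} ≤ μ (Set.Iic x)ᶜ := measure_mono fun z hz hzx =>
          absurd (hx.2.trans_le hz) (not_lt.2 (EReal.coe_le_coe_iff.2 hzx))
      _ = ENNReal.ofReal (1 - F x) := by
          rw [prob_compl_eq_one_sub measurableSet_Iic, hμ.2 x hx.1 hx.2, ← ENNReal.ofReal_one,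
            ENNReal.ofReal_sub _ (hF.mapsTo hx).1]
      _ ≤ 0 + ε := by
          rw [zero_add]
          exact ENNReal.ofReal_le_of_le_toReal (by simp; linarith)
  filter_upwards [h1, h2] with x hx1 hx2
  exact ⟨(not_le.1 hx1).le, not_le.1 hx2⟩

lemma integral_mem_support {Ω : Type*} [MeasurableSpace Ω] {P : Measure Ω} [IsProbabilityMeasure P]
    {X : Ω → ℝ} {a : ℝ} {b : EReal} (h : ∀ᵐ ω ∂P, a ≤ X ω ∧ (X ω : EReal) < b)
    (hX : Integrable X P) : ∫ ω, X ω ∂P ∈ {x : ℝ | a ≤ x ∧ (x : EReal) < b} := by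
  constructor
  · calc a = ∫ _, a ∂P := by simp
      _ ≤ _ := integral_mono_ae (integrable_const a) hX (h.mono fun ω hω => hω.1)
  · by_contra! hb
    set p := ∫ ω, X ω ∂P with hp
    have hlt : ∀ᵐ ω ∂P, X ω < p :=
      h.mono fun ω hω => EReal.coe_lt_coe_iff.1 (hω.2.trans_le hb)
    have h0 : ∫ ω, (p - X ω) ∂P = 0 := by
      rw [integral_sub (integrable_const p) hX]
      simp [← hp]
    rw [integral_eq_zero_iff_of_nonneg_ae (hlt.mono fun ω hω => (sub_pos.2 hω).le)
      ((integrable_const p).sub hX)] at h0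
    obtain ⟨ω, hω, hω0⟩ := (hlt.and h0).exists
    simp only [Pi.zero_apply] at hω0
    linarith

/-- The maximum of `s` draws from a `λ`-regular distribution exceeds its mean with probability
at least `c(λ)`. -/
theorem cReg_le_one_sub_pow {l : ℝ} (hl : l ∈ Set.Ico (0 : ℝ) 1) {F f : ℝ → ℝ} {a : ℝ} {b : EReal}
    {μ : Measure ℝ} [IsProbabilityMeasure μ] (hF : IsCDF F f a b) (hμ : InducedBy μ F a b)
    (hreg : LambdaRegular l F f a b) (hint : Integrable id μ) {s : ℕ} (hs : 1 ≤ s) :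
    cReg l ≤ 1 - F (orderStatExp μ 1 s) ^ s := by
  obtain ⟨m, rfl⟩ : ∃ m, s = m + 1 := ⟨s - 1, by omega⟩
  set I := {x : ℝ | a ≤ x ∧ (x : EReal) < b}
  have hIc : I.OrdConnected := ordConnected_support a b
  have hmo := measurable_orderStat (t := m + 1) le_rfl hs
  set ν := (Measure.pi fun _ : Fin (m + 1) => μ).map (orderStat (m + 1) 1) with hν
  have : IsProbabilityMeasure ν := Measure.isProbabilityMeasure_map hmo.aemeasurable
  have hImeas : MeasurableSet I := hIc.measurableSet
  have hI : ∀ᵐ x ∂ν, x ∈ I :=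
    (ae_map_iff hmo.aemeasurable hImeas).2 (ae_orderStat (hμ.ae_mem hF) le_rfl hs)
  have hνint : Integrable id ν :=
    (integrable_map_measure aestronglyMeasurable_id hmo.aemeasurable).2
      (integrable_orderStat hint le_rfl hs)
  have hmean : orderStatExp μ 1 (m + 1) = ∫ x, x ∂ν := by
    rw [hν, integral_map hmo.aemeasurable measurable_id.aestronglyMeasurable (f := fun x => x)]
    rfl
  have hFm := hF.mapsTo
  have hder : ∀ x ∈ I, HasDerivAt F (f x) x := fun x hx => (hF.2.2.2.1 x hx.1 hx.2).1
  have hfpos : ∀ x ∈ I, 0 < f x := fun x hx => (hF.2.2.2.1 x hx.1 hx.2).2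
  have hGmeas : Measurable fun x => F x ^ (m + 1) := hF.2.1.measurable.pow_const _
  have hGmaps : Set.MapsTo (fun x => F x ^ (m + 1)) I (Set.Ico 0 1) := fun x hx =>
    ⟨pow_nonneg (hFm hx).1 _, pow_lt_one₀ (hFm hx).1 (hFm hx).2 m.succ_ne_zero⟩
  have hU : ν.map (fun x => F x ^ (m + 1)) = volume.restrict (Set.Icc 0 1) := by
    refine map_cdf_eq_uniform hGmeas hI
      (fun x hx y hy hxy => pow_lt_pow_left₀ (hF.strictMonoOn hx hy hxy) (hFm hx).1 m.succ_ne_zero)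
      (fun x hx => ?_) hGmaps (hF.surjOn_pow m.succ_ne_zero)
    rw [map_orderStat_one_Iic hs, hμ.2 x hx.1 hx.2, ENNReal.ofReal_pow (hFm hx).1]
  have hmono := monotoneOn_density_pow hl.2.le hFm (hF.2.1.monotoneOn I) hfpos
    (monotoneOn_density_div_rpow hIc hl.1 (fun x hx => (hFm hx).2) hder hfpos hreg) m
  rw [hmean]
  exact cReg_le_one_sub_cdf_mean (G := fun x => F x ^ (m + 1)) hl.1 hl.2 hGmeas hI hIc hU hνint
    (integral_mem_support hI hνint) (fun x hx => (hGmaps hx).2)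
    (fun x hx => (hder x hx).pow (m + 1)) hmono

lemma half_one_sub_pow_le {q : ℝ} (h0 : 0 ≤ q) (h1 : q ≤ 1) {s : ℕ} (hs : 1 ≤ s) :
    (1 - q ^ s) / 2 ≤ 1 - q ^ (if 2 ≤ s then s - 1 else 1) := by
  split_ifs with h
  · obtain ⟨m, rfl⟩ : ∃ m, s = m + 1 + 1 := ⟨s - 2, by omega⟩
    have hq : q ^ (m + 1) ≤ q := pow_le_of_le_one h0 h1 m.succ_ne_zero
    have hq0 : q ^ (m + 1) ≤ 1 := pow_le_one₀ h0 h1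
    rw [pow_succ q (m + 1), Nat.add_sub_cancel]
    nlinarith [mul_nonneg (sub_nonneg.2 hq0) (sub_nonneg.2 h1)]
  · obtain rfl : s = 1 := by omega
    rw [pow_one]
    linarith

theorem stmt1 (lam : ℝ) (hlam : lam ∈ Set.Ico (0:ℝ) 1)
    (F f : ℝ → ℝ) (a : ℝ) (b : EReal) (ha : 0 ≤ a)
    (μ : Measure ℝ)
    (hF : IsCDF F f a b) (hμ : InducedBy μ F a b)
    (hreg : LambdaRegular lam F f a b)
    (n k : ℕ) (hk : 1 ≤ k) (hkn : k ≤ n)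
    (hint : Integrable (orderStat n 1) (Measure.pi fun _ : Fin n => μ))
    (s : ℕ) (hs : s = ⌈(n : ℝ) / k⌉₊)
    (s' : ℕ) (hs' : s' = if 2 ≤ s then s - 1 else 1)
    (p : ℝ) (hp : p = orderStatExp μ 1 s) :
    (k : ℝ) * p * (1 - (F p) ^ s') ≥
      (cReg lam / 2) * (1 - 1 / Real.exp 1) * ∑ j ∈ Finset.Icc 1 k, orderStatExp μ j n := by
  have hprob := hμ.1
  have h0 : ∀ᵐ y ∂μ, 0 ≤ y := (hμ.ae_mem hF).mono fun y hy => ha.trans hy.1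
  have hid := integrable_id_of_integrable_orderStat h0 (hk.trans hkn) hint
  have hk0 : (0 : ℝ) < k := by exact_mod_cast hk
  have hn0 : (0 : ℝ) < n := by exact_mod_cast hk.trans hkn
  have hs1 : 1 ≤ s := hs ▸ Nat.one_le_ceil_iff.2 (div_pos hn0 hk0)
  have hns : n ≤ k * s := by
    have h := Nat.le_ceil ((n : ℝ) / k)
    rw [← hs, div_le_iff₀' hk0] at h
    exact_mod_cast h
  have hp0 : 0 ≤ p := hp ▸ orderStatExp_nonneg h0 le_rfl hs1
  have hF0 : 0 ≤ F p ∧ F p ≤ 1 := by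
    have h := hF.mapsTo (integral_mem_support (ae_orderStat (hμ.ae_mem hF) le_rfl hs1)
      (integrable_orderStat hid le_rfl hs1))
    rw [hp]
    exact ⟨h.1, h.2.le⟩
  have hgap := sum_orderStatExp_le h0 hid hk hkn hs1 hns
  have hc := cReg_le_one_sub_pow hlam hF hμ hreg hid hs1
  rw [← hp] at hgap hc
  have hhalf := half_one_sub_pow_le hF0.1 hF0.2 hs1
  rw [← hs'] at hhalf
  have hc0 := cReg_nonneg hlam.2.le
  calc cReg lam / 2 * (1 - 1 / Real.exp 1) * ∑ j ∈ Finset.Icc 1 k, orderStatExp μ j n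
      = cReg lam / 2 * ((1 - 1 / Real.exp 1) * ∑ j ∈ Finset.Icc 1 k, orderStatExp μ j n) := by ring
    _ ≤ cReg lam / 2 * (k * p) := by gcongr
    _ = k * p * (cReg lam / 2) := by ring
    _ ≤ k * p * (1 - F p ^ s') := by
        gcongr
        linarith
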